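/- arXiv:2202.09032 — 3 statements merged into one kernel-verified Lean document; each statement's English description precedes it below -/
import Mathlib

section
/- Let K be a field equipped with a nonarchimedean absolute value |·|, and let d ≥ 2 be an integer such that |d·1_K| = 1. If g ∈ K satisfies |g^{d^n} − 1| → 0 as n → ∞, then there exists an integer m ≥ 1 such that g^{d^m} = 1. -/
namespace AbsoluteValue

variable {K : Type*} [Field K] {v : AbsoluteValue K ℝ}

theorem pow_sub_one_le_of_isNonarchimedean (hna : IsNonarchimedean v) {x : K}
    (hx : v x ≤ 1) (n : ℕ) : v (x ^ n - 1) ≤ v (x - 1) := by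
  induction n with
  | zero => simp
  | succ n ih =>
    have h : x ^ (n + 1) - 1 = x * (x ^ n - 1) + (x - 1) := by ring
    rw [h]
    refine (hna _ _).trans (max_le ?_ le_rfl)
    rw [v.map_mul]
    exact (mul_le_of_le_one_left (v.nonneg _) hx).trans ih

theorem geom_sum_sub_natCast_le_of_isNonarchimedean (hna : IsNonarchimedean v) {x : K}
    (hx : v x ≤ 1) (n : ℕ) : v (∑ i ∈ Finset.range n, x ^ i - n) ≤ v (x - 1) := by
  induction n with
  | zero => simp
  | succ n ih =>
    have h : ∑ i ∈ Finset.range (n + 1), x ^ i - ((n + 1 : ℕ) : K) =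
        (∑ i ∈ Finset.range n, x ^ i - n) + (x ^ n - 1) := by
      rw [Finset.sum_range_succ]
      push_cast
      ring
    rw [h]
    exact (hna _ _).trans (max_le ih (pow_sub_one_le_of_isNonarchimedean hna hx n))

/-- On the open unit ball around `1`, raising to a power `d` with `|d| = 1` preserves the
distance to `1`. -/
theorem pow_sub_one_eq_of_isNonarchimedean (hna : IsNonarchimedean v) {d : ℕ}
    (hd : v (d : K) = 1) {x : K} (hx : v (x - 1) < 1) : v (x ^ d - 1) = v (x - 1) := by
  have hx1 : v x ≤ 1 := by
    simpa [hx.le] using hna (x - 1) 1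
  have hlt := (geom_sum_sub_natCast_le_of_isNonarchimedean hna hx1 d).trans_lt hx
  have hsum : v (∑ i ∈ Finset.range d, x ^ i) = 1 := by
    have h := hna.add_eq_right_of_lt (hlt.trans_eq hd.symm)
    rwa [sub_add_cancel, hd] at h
  rw [← geom_sum_mul, v.map_mul, hsum, one_mul]

end AbsoluteValue

/-- If `|·|` is a nonarchimedean absolute value on a field `K`, `d ≥ 2` with
`|d·1| = 1`, and `g ∈ K` satisfies `|g^{d^n} − 1| → 0`, then `g^{d^m} = 1` for
some `m ≥ 1`. -/
theorem statement3 (K : Type*) [Field K] (v : AbsoluteValue K ℝ)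
    (hna : IsNonarchimedean (fun x => v x)) (d : ℕ) (hd : 2 ≤ d)
    (hdv : v ((d : K)) = 1) (g : K)
    (hg : Filter.Tendsto (fun n : ℕ => v (g ^ d ^ n - 1)) Filter.atTop (nhds 0)) :
    ∃ m : ℕ, 1 ≤ m ∧ g ^ d ^ m = 1 := by
  obtain ⟨N, hN⟩ := Filter.eventually_atTop.mp (hg.eventually_lt_const one_pos)
  have hconst : ∀ n ≥ N + 1, v (g ^ d ^ n - 1) = v (g ^ d ^ (N + 1) - 1) := by
    intro n hn
    induction n, hn using Nat.le_induction with
    | base => rfl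
    | succ n hn ih =>
      rw [pow_succ d n, pow_mul,
        AbsoluteValue.pow_sub_one_eq_of_isNonarchimedean hna hdv (hN n (by omega)), ih]
  have hzero : v (g ^ d ^ (N + 1) - 1) = 0 :=
    tendsto_nhds_unique (tendsto_atTop_of_eventually_const hconst) hg
  exact ⟨N + 1, by omega, sub_eq_zero.mp (v.eq_zero.mp hzero)⟩
end

section
/- The function f, defined on the open unit disc of ℂ by f(x) = Σ_{n=2}^∞ h_n(x)/n!, is differentiable at 0 with derivative f'(0) = e − 2, where e = exp(1). -/
/-- `h_n(x) := x·∏_{i=2}^n (1 − i·x)`. -/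
noncomputable def hfun (n : ℕ) (x : ℂ) : ℂ := x * ∏ i ∈ Finset.Icc 2 n, (1 - (i : ℂ) * x)

/-- `f(x) := Σ_{n=2}^∞ h_n(x)/n!`. -/
noncomputable def ffun (x : ℂ) : ℂ :=
  ∑' n : ℕ, hfun (n + 2) x / ((Nat.factorial (n + 2) : ℕ) : ℂ)

lemma norm_prod_one_sub_natCast_mul_le {x : ℂ} (hx : ‖x‖ ≤ 1 / 4) (n : ℕ) :
    ‖∏ i ∈ Finset.Icc 2 (n + 2), (1 - (i : ℂ) * x)‖ ≤
      (3 / 4 : ℝ) ^ (n + 1) * (Nat.factorial (n + 2) : ℝ) := by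
  have hfactor (m : ℕ) : ‖1 - ((m + 2 : ℕ) : ℂ) * x‖ ≤ 3 / 4 * ((m + 2 : ℕ) : ℝ) := by
    calc ‖1 - ((m + 2 : ℕ) : ℂ) * x‖ ≤ ‖(1 : ℂ)‖ + ‖((m + 2 : ℕ) : ℂ) * x‖ := norm_sub_le _ _
      _ = 1 + ((m + 2 : ℕ) : ℝ) * ‖x‖ := by rw [norm_one, norm_mul, Complex.norm_natCast]
      _ ≤ 1 + ((m + 2 : ℕ) : ℝ) * (1 / 4) := by gcongr
      _ ≤ 3 / 4 * ((m + 2 : ℕ) : ℝ) := by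
        push_cast
        linarith [Nat.cast_nonneg (α := ℝ) m]
  induction n with
  | zero => simpa [Nat.factorial] using hfactor 0
  | succ k ih =>
    rw [show k + 1 + 2 = k + 2 + 1 by ring, Finset.prod_Icc_succ_top (by omega), norm_mul,
      Nat.factorial_succ]
    calc _ ≤ ((3 / 4 : ℝ) ^ (k + 1) * (Nat.factorial (k + 2) : ℝ)) *
          (3 / 4 * ((k + 1 + 2 : ℕ) : ℝ)) :=
          mul_le_mul ih (hfactor (k + 1)) (norm_nonneg _) (by positivity)
      _ = _ := by push_cast; ring

lemma norm_hfun_div_factorial_le {x : ℂ} (hx : ‖x‖ ≤ 1 / 4) (n : ℕ) :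
    ‖hfun (n + 2) x / ((Nat.factorial (n + 2) : ℕ) : ℂ)‖ ≤ (3 / 4 : ℝ) ^ (n + 1) := by
  rw [norm_div, Complex.norm_natCast, div_le_iff₀ (by positivity), hfun, norm_mul]
  exact (mul_le_of_le_one_left (norm_nonneg _) (by linarith)).trans
    (norm_prod_one_sub_natCast_mul_le hx n)

lemma differentiable_hfun (n : ℕ) : Differentiable ℂ (hfun n) := by
  unfold hfun
  fun_prop

lemma hasDerivAt_hfun_zero (n : ℕ) : HasDerivAt (hfun n) 1 0 := by
  have hp : DifferentiableAt ℂ (fun x : ℂ => ∏ i ∈ Finset.Icc 2 n, (1 - (i : ℂ) * x)) 0 := by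
    fun_prop
  simpa [hfun] using! (hasDerivAt_id (0 : ℂ)).mul hp.hasDerivAt

lemma hasSum_one_div_factorial_add_two :
    HasSum (fun n : ℕ => 1 / ((Nat.factorial (n + 2) : ℕ) : ℂ)) ((Real.exp 1 : ℂ) - 2) := by
  have h : HasSum (fun n : ℕ => 1 / ((Nat.factorial n : ℕ) : ℂ)) (Real.exp 1 : ℂ) := by
    have := NormedSpace.expSeries_div_hasSum_exp (1 : ℂ)
    rw [← Complex.exp_eq_exp_ℂ] at this
    simpa using this
  rw [hasSum_nat_add_iff' 2 |>.symm] at h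
  convert! h using 2
  norm_num [Finset.sum_range_succ]

/-- `f` is differentiable at `0` with `f'(0) = e − 2`. -/
theorem statement10 : HasDerivAt ffun ((Real.exp 1 : ℂ) - 2) 0 := by
  have hu : Summable fun n : ℕ => (3 / 4 : ℝ) ^ (n + 1) :=
    (summable_nat_add_iff 1).2 (summable_geometric_of_lt_one (by norm_num) (by norm_num))
  have hd (n : ℕ) : DifferentiableOn ℂ
      (fun x => hfun (n + 2) x / ((Nat.factorial (n + 2) : ℕ) : ℂ)) (Metric.ball 0 (1 / 4)) :=
    ((differentiable_hfun (n + 2)).div_const _).differentiableOn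
  have hle (n : ℕ) (x : ℂ) (hx : x ∈ Metric.ball (0 : ℂ) (1 / 4)) :
      ‖hfun (n + 2) x / ((Nat.factorial (n + 2) : ℕ) : ℂ)‖ ≤ (3 / 4 : ℝ) ^ (n + 1) :=
    norm_hfun_div_factorial_le (mem_ball_zero_iff.1 hx).le n
  have h0 : (0 : ℂ) ∈ Metric.ball (0 : ℂ) (1 / 4) := Metric.mem_ball_self (by norm_num)
  have hdiff : DifferentiableAt ℂ ffun 0 :=
    (Complex.differentiableOn_tsum_of_summable_norm hu hd Metric.isOpen_ball hle).differentiableAt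
      (Metric.isOpen_ball.mem_nhds h0)
  have hsum := Complex.hasSum_deriv_of_summable_norm hu hd Metric.isOpen_ball hle h0
  simp_rw [fun n : ℕ => ((hasDerivAt_hfun_zero (n + 2)).div_const
    ((Nat.factorial (n + 2) : ℕ) : ℂ)).deriv] at hsum
  rw [← hsum.unique hasSum_one_div_factorial_add_two]
  exact hdiff.hasDerivAt
end

section
/- Let p be a prime and let r > 0. Let c : ℕ → ℚ be a sequence such that the series Σ_{k≥0} c_k z^k converges in ℚ_p for every z ∈ ℚ_p with |z|_p < r; let h(z) denote its sum. Let (x_n)_{n∈ℕ} be a sequence of nonzero rational numbers with |x_n|_p < r and |x_n|_p → 0, and suppose that for every n the value y_n := h(x_n) ∈ ℚ_p is a rational number. Assume there exists ε > 0 such that for all sufficiently large n one has −log|x_n|_p ≥ ε·( log max(1, |num(x_n)|, den(x_n)) + log max(1, |num(y_n)|, den(y_n)) ). Then there exist a nonzero polynomial P ∈ ℚ[X,Y] and m₀ ∈ ℕ such that P(x_n, y_n) = 0 for all n ≥ m₀. -/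
/-- The naive logarithmic (Weil) height of a rational number `q`:
`log max(1, |num q|, den q)`. -/
noncomputable def ratHeight (q : ℚ) : ℝ :=
  Real.log (max 1 (max (|q.num| : ℝ) (q.den : ℝ)))

open Filter Asymptotics Finset

/-- A nonzero integer `M` satisfies `|M| * |M|_p ≥ 1`. -/
theorem one_le_abs_mul_norm_padic (p : ℕ) [Fact p.Prime] (M : ℤ) (hM : M ≠ 0) :
    1 ≤ |(M : ℝ)| * ‖(M : ℚ_[p])‖ := by
  have hp : (0 : ℝ) < p := by exact_mod_cast (Fact.out : p.Prime).pos
  have hle : ((p : ℝ) ^ padicValInt p M) ≤ |(M : ℝ)| := by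
    have h := Int.le_of_dvd (abs_pos.mpr hM) ((dvd_abs _ _).mpr (padicValInt_dvd (p := p) M))
    exact_mod_cast h
  have hnorm : ‖(M : ℚ_[p])‖ = ((p : ℝ) ^ padicValInt p M)⁻¹ := by
    rw [Padic.norm_eq_zpow_neg_valuation (by exact_mod_cast hM), Padic.valuation_intCast,
      zpow_neg, zpow_natCast]
  rw [hnorm, ← div_eq_mul_inv, one_le_div (by positivity)]
  exact hle

/-- The exponential of `ratHeight`. -/
theorem exp_ratHeight (q : ℚ) :
    Real.exp (ratHeight q) = max 1 (max (|q.num| : ℝ) (q.den : ℝ)) :=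
  Real.exp_log (lt_of_lt_of_le one_pos (le_max_left _ _))

/-- Homogenizing a bounded power of a rational number. -/
theorem exists_int_pow_mul_den_pow (q : ℚ) {i d : ℕ} (hi : i ≤ d) :
    ∃ m : ℤ, (m : ℚ) = q ^ i * (q.den : ℚ) ^ d ∧ |(m : ℝ)| ≤ Real.exp (ratHeight q) ^ d := by
  refine ⟨q.num ^ i * (q.den : ℤ) ^ (d - i), ?_, ?_⟩
  · have h : (q.num : ℚ) = q * q.den := (Rat.mul_den_eq_num q).symm
    push_cast
    rw [h, mul_pow, mul_assoc, ← pow_add, Nat.add_sub_cancel' hi]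
  · rw [exp_ratHeight]
    push_cast
    rw [abs_mul, abs_pow, abs_pow, Nat.abs_cast]
    conv_rhs => rw [← Nat.add_sub_cancel' hi, pow_add]
    gcongr
    · exact (le_max_left _ _).trans (le_max_right _ _)
    · exact (le_max_right _ _).trans (le_max_right _ _)

/-- Liouville-type lower bound for the `p`-adic size of a nonzero value of an integer polynomial
of bidegree at most `(d, d)`. -/
theorem one_le_mul_norm_eval (p : ℕ) [Fact p.Prime] (d : ℕ)
    (a : Fin (d + 1) × Fin (d + 1) → ℤ) (x y : ℚ)
    (hu : ∑ s, (a s : ℚ) * (x ^ (s.1 : ℕ) * y ^ (s.2 : ℕ)) ≠ 0) :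
    1 ≤ (∑ s, |(a s : ℝ)|) * Real.exp (ratHeight x + ratHeight y) ^ d *
      ‖((∑ s, (a s : ℚ) * (x ^ (s.1 : ℕ) * y ^ (s.2 : ℕ)) : ℚ) : ℚ_[p])‖ := by
  set u : ℚ := ∑ s, (a s : ℚ) * (x ^ (s.1 : ℕ) * y ^ (s.2 : ℕ)) with hu_def
  choose f hf hfle using fun i : Fin (d + 1) =>
    exists_int_pow_mul_den_pow x (Nat.le_of_lt_succ i.isLt)
  choose g hg hgle using fun i : Fin (d + 1) =>
    exists_int_pow_mul_den_pow y (Nat.le_of_lt_succ i.isLt)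
  set M : ℤ := ∑ s, a s * (f s.1 * g s.2) with hM_def
  have hMu : (M : ℚ) = u * ((x.den ^ d * y.den ^ d : ℤ) : ℚ) := by
    rw [hM_def, hu_def, Finset.sum_mul]
    push_cast
    refine Finset.sum_congr rfl fun s _ => ?_
    rw [hf, hg]
    ring
  have hM0 : M ≠ 0 := by
    have : (M : ℚ) ≠ 0 := by
      rw [hMu]
      refine mul_ne_zero hu ?_
      have := x.den_nz
      have := y.den_nz
      push_cast
      positivity
    exact_mod_cast this
  have hMabs : |(M : ℝ)| ≤ (∑ s, |(a s : ℝ)|) * Real.exp (ratHeight x + ratHeight y) ^ d := by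
    rw [hM_def, Real.exp_add, mul_pow, Finset.sum_mul]
    push_cast
    refine (Finset.abs_sum_le_sum_abs _ _).trans (Finset.sum_le_sum fun s _ => ?_)
    rw [abs_mul, abs_mul]
    gcongr
    · exact hfle _
    · exact hgle _
  have hMnorm : ‖(M : ℚ_[p])‖ ≤ ‖(u : ℚ_[p])‖ := by
    have h : (M : ℚ_[p]) = (u : ℚ_[p]) * ((x.den ^ d * y.den ^ d : ℤ) : ℚ_[p]) := by
      have := congrArg (fun q : ℚ => (q : ℚ_[p])) hMu
      simpa only [Rat.cast_mul, Rat.cast_intCast] using this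
    rw [h, norm_mul]
    exact mul_le_of_le_one_right (norm_nonneg _) (Padic.norm_int_le_one _)
  calc 1 ≤ |(M : ℝ)| * ‖(M : ℚ_[p])‖ := one_le_abs_mul_norm_padic p M hM0
    _ ≤ _ := by gcongr

/-- There is a nonzero integer polynomial of bidegree at most `(d, d)` whose value at `(X, T)` is
divisible by `X ^ N`, provided that `N < (d + 1) ^ 2`. -/
theorem exists_int_coeffs_X_pow_dvd (d N : ℕ) (hN : N < (d + 1) ^ 2) (T : Polynomial ℚ) :
    ∃ a : Fin (d + 1) × Fin (d + 1) → ℤ, a ≠ 0 ∧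
      Polynomial.X ^ N ∣
        ∑ s, Polynomial.C (a s : ℚ) * (Polynomial.X ^ (s.1 : ℕ) * T ^ (s.2 : ℕ)) := by
  let L : (Fin (d + 1) × Fin (d + 1) → ℚ) →ₗ[ℚ] (Fin N → ℚ) :=
    LinearMap.pi (fun k : Fin N => Polynomial.lcoeff ℚ (k : ℕ)) ∘ₗ
      Fintype.linearCombination ℚ
        (fun s : Fin (d + 1) × Fin (d + 1) =>
          (Polynomial.X ^ (s.1 : ℕ) * T ^ (s.2 : ℕ) : Polynomial ℚ))
  have hker : LinearMap.ker L ≠ ⊥ := by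
    refine LinearMap.ker_ne_bot_of_finrank_lt ?_
    simpa [Fintype.card_prod, ← sq] using hN
  obtain ⟨b, hb, hb0⟩ := Submodule.exists_mem_ne_zero_of_ne_bot hker
  obtain ⟨D, hD⟩ := IsLocalization.exist_integer_multiples_of_finite (nonZeroDivisors ℤ) b
  choose a ha using hD
  have ha' : ∀ s, (a s : ℚ) = ((D : ℤ) : ℚ) * b s := fun s => by
    simpa [Algebra.smul_def] using ha s
  have hD0 : ((D : ℤ) : ℚ) ≠ 0 := by exact_mod_cast nonZeroDivisors.coe_ne_zero D
  refine ⟨a, fun h => hb0 (funext fun s => ?_), ?_⟩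
  · have := ha' s
    rw [h] at this
    simpa [hD0] using this.symm
  · have hsum : ∑ s, Polynomial.C (a s : ℚ) * (Polynomial.X ^ (s.1 : ℕ) * T ^ (s.2 : ℕ)) =
        Polynomial.C ((D : ℤ) : ℚ) *
          ∑ s, b s • (Polynomial.X ^ (s.1 : ℕ) * T ^ (s.2 : ℕ) : Polynomial ℚ) := by
      rw [Finset.mul_sum]
      refine Finset.sum_congr rfl fun s _ => ?_
      rw [ha', Polynomial.smul_eq_C_mul, map_mul, mul_assoc]
    rw [hsum]
    refine Dvd.dvd.mul_left (Polynomial.X_pow_dvd_iff.mpr fun k hk => ?_) _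
    have := congrFun (LinearMap.mem_ker.mp hb) ⟨k, hk⟩
    simpa [L, Fintype.linearCombination_apply] using this

/-- Truncating a convergent `p`-adic power series at order `N` leaves an error `O(z ^ N)`. -/
theorem exists_norm_tsum_sub_le (p : ℕ) [Fact p.Prime] (c : ℕ → ℚ_[p]) (z₀ : ℚ_[p])
    (hz₀ : z₀ ≠ 0) (hs : Summable fun k => c k * z₀ ^ k) (N : ℕ) :
    ∃ C : ℝ, ∀ z : ℚ_[p], ‖z‖ ≤ ‖z₀‖ → Summable (fun k => c k * z ^ k) →
      ‖∑' k, c k * z ^ k - ∑ k ∈ range N, c k * z ^ k‖ ≤ C * ‖z ^ N‖ := by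
  obtain ⟨B, hB⟩ := hs.tendsto_atTop_zero.norm.bddAbove_range
  have hB' : ∀ k, ‖c k‖ * ‖z₀‖ ^ k ≤ B := fun k => by
    simpa using hB (Set.mem_range_self k)
  have hpos : 0 < ‖z₀‖ := norm_pos_iff.mpr hz₀
  have hB0 : 0 ≤ B := le_trans (by positivity) (hB' 0)
  refine ⟨B / ‖z₀‖ ^ N, fun z hz hsz => ?_⟩
  rw [← hsz.sum_add_tsum_nat_add N, add_sub_cancel_left]
  refine IsUltrametricDist.norm_tsum_le_of_forall_le_of_nonneg (by positivity) fun k => ?_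
  rw [norm_mul, norm_pow, norm_pow, pow_add, div_mul_eq_mul_div, le_div_iff₀ (by positivity)]
  calc ‖c (k + N)‖ * (‖z‖ ^ k * ‖z‖ ^ N) * ‖z₀‖ ^ N
      ≤ ‖c (k + N)‖ * (‖z₀‖ ^ k * ‖z‖ ^ N) * ‖z₀‖ ^ N := by gcongr
    _ = ‖c (k + N)‖ * ‖z₀‖ ^ (k + N) * ‖z‖ ^ N := by ring
    _ ≤ B * ‖z‖ ^ N := by gcongr; exact hB' _

/-- If `v - w = O(g)` with `v`, `w` bounded, then `v ^ j - w ^ j = O(g)`. -/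
theorem isBigO_pow_sub_pow {α 𝕜 : Type*} [NormedField 𝕜] {l : Filter α} {v w g : α → 𝕜}
    (hv : v =O[l] fun _ => (1 : 𝕜)) (hw : w =O[l] fun _ => (1 : 𝕜))
    (hvw : (fun n => v n - w n) =O[l] g) (j : ℕ) :
    (fun n => v n ^ j - w n ^ j) =O[l] g := by
  induction j with
  | zero => simpa using isBigO_zero g l
  | succ j ih =>
    have h₁ : (fun n => v n ^ j * (v n - w n)) =O[l] g := by
      simpa using (hv.pow j).mul hvw
    have h₂ : (fun n => (v n ^ j - w n ^ j) * w n) =O[l] g := by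
      simpa using ih.mul hw
    refine (h₁.add h₂).congr_left fun n => ?_
    ring

/-- A polynomial in a null sequence is bounded. -/
theorem isBigO_eval₂_one {α 𝕜 : Type*} [NormedField 𝕜] [CharZero 𝕜] {l : Filter α} {z : α → 𝕜}
    (hz : Tendsto z l (nhds 0)) (Q : Polynomial ℚ) :
    (fun n => Q.eval₂ (Rat.castHom 𝕜) (z n)) =O[l] fun _ => (1 : 𝕜) := by
  have h := ((Q.map (Rat.castHom 𝕜)).continuous.tendsto 0).comp hz
  simpa [Function.comp_def, Polynomial.eval_map] using h.isBigO_one 𝕜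

/-- Graph special case, over `K = ℚ` at a nonarchimedean place `p`, of the
algebraicity criterion: a `p`-adic analytic curve `y = h(x)` with rational
coefficients containing infinitely many rational points approaching the origin
`p`-adically, with `p`-adic closeness `-log |x_n|_p` comparable to the height of
`(x_n, y_n)`, is algebraic over `ℚ`. -/
theorem statement16 (p : ℕ) [Fact p.Prime] (r : ℝ) (hr : 0 < r) (c : ℕ → ℚ)
    (hconv : ∀ z : ℚ_[p], ‖z‖ < r → Summable (fun k : ℕ => (c k : ℚ_[p]) * z ^ k))
    (h : ℚ_[p] → ℚ_[p])
    (hdef : ∀ z : ℚ_[p], ‖z‖ < r → h z = ∑' k : ℕ, (c k : ℚ_[p]) * z ^ k)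
    (x : ℕ → ℚ) (hx0 : ∀ n, x n ≠ 0) (hxr : ∀ n, ‖((x n : ℚ) : ℚ_[p])‖ < r)
    (hxlim : Filter.Tendsto (fun n => ‖((x n : ℚ) : ℚ_[p])‖) Filter.atTop (nhds 0))
    (y : ℕ → ℚ) (hy : ∀ n, ((y n : ℚ) : ℚ_[p]) = h ((x n : ℚ) : ℚ_[p]))
    (ε : ℝ) (hε : 0 < ε)
    (hht : ∀ᶠ n in Filter.atTop,
      -Real.log ‖((x n : ℚ) : ℚ_[p])‖ ≥ ε * (ratHeight (x n) + ratHeight (y n))) :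
    ∃ P : MvPolynomial (Fin 2) ℚ, P ≠ 0 ∧ ∃ m₀ : ℕ, ∀ n ≥ m₀,
      MvPolynomial.eval ![x n, y n] P = 0 := by
  obtain ⟨K, hK⟩ := exists_nat_ge (1 / ε)
  set N := K ^ 2 + 1
  have hKpos : 0 < K := by
    have : (0 : ℝ) < K := lt_of_lt_of_le (by positivity) hK
    exact_mod_cast this
  set z : ℕ → ℚ_[p] := fun n => ((x n : ℚ) : ℚ_[p]) with hz_def
  set w : ℕ → ℚ_[p] := fun n => ((y n : ℚ) : ℚ_[p]) with hw_def
  have hz : Tendsto z atTop (nhds 0) := tendsto_zero_iff_norm_tendsto_zero.mpr hxlim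
  have hz0 : ∀ n, z n ≠ 0 := fun n => by simpa [hz_def] using hx0 n
  set T : Polynomial ℚ := ∑ k ∈ range N, Polynomial.C (c k) * Polynomial.X ^ k
  set Tz : ℕ → ℚ_[p] := fun n => T.eval₂ (Rat.castHom ℚ_[p]) (z n) with hTz_def
  have hTsum : ∀ n, Tz n = ∑ k ∈ range N, (c k : ℚ_[p]) * z n ^ k := fun n => by
    simp [hTz_def, T, Polynomial.eval₂_finsetSum]
  obtain ⟨a, ha0, S, hS⟩ := exists_int_coeffs_X_pow_dvd K N (by simp only [N]; nlinarith) T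
  have hTO : Tz =O[atTop] fun _ => (1 : ℚ_[p]) := isBigO_eval₂_one hz T
  have hdiff : (fun n => w n - Tz n) =O[atTop] fun n => z n ^ N := by
    obtain ⟨C, hC⟩ := exists_norm_tsum_sub_le p (fun k => (c k : ℚ_[p])) (z 0) (hz0 0)
      (hconv _ (hxr 0)) N
    refine IsBigO.of_bound C ?_
    filter_upwards [hxlim.eventually_lt_const (norm_pos_iff.mpr (hz0 0))] with n hn
    have hwn : w n = ∑' k, (c k : ℚ_[p]) * z n ^ k := (hy n).trans (hdef _ (hxr n))
    rw [hwn, hTsum]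
    exact hC _ hn.le (hconv _ (hxr n))
  have hzO : z =O[atTop] fun _ => (1 : ℚ_[p]) := hz.isBigO_one _
  have hwO : w =O[atTop] fun _ => (1 : ℚ_[p]) := by
    have h₁ : (fun n => z n ^ N) =O[atTop] fun _ => (1 : ℚ_[p]) := by simpa using hzO.pow N
    exact ((hdiff.trans h₁).add hTO).congr_left fun n => by ring
  set u : ℕ → ℚ := fun n => ∑ s, (a s : ℚ) * (x n ^ (s.1 : ℕ) * y n ^ (s.2 : ℕ)) with hu_def
  have huO : (fun n => ((u n : ℚ) : ℚ_[p])) =O[atTop] fun n => z n ^ N := by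
    have h₁ : (fun n => ∑ s, (a s : ℚ_[p]) *
        (z n ^ (s.1 : ℕ) * (w n ^ (s.2 : ℕ) - Tz n ^ (s.2 : ℕ)))) =O[atTop] fun n => z n ^ N := by
      refine IsBigO.fun_sum fun s _ => IsBigO.const_mul_left ?_ _
      simpa using (hzO.pow (s.1 : ℕ)).mul (isBigO_pow_sub_pow hwO hTO hdiff (s.2 : ℕ))
    have h₂ : (fun n => z n ^ N * S.eval₂ (Rat.castHom ℚ_[p]) (z n)) =O[atTop]
        fun n => z n ^ N := by
      simpa using (isBigO_refl (fun n => z n ^ N) atTop).mul (isBigO_eval₂_one hz S)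
    refine (h₁.add h₂).congr_left fun n => ?_
    have h₃ := congrArg (Polynomial.eval₂ (Rat.castHom ℚ_[p]) (z n)) hS
    simp only [Polynomial.eval₂_finsetSum, Polynomial.eval₂_mul, Polynomial.eval₂_pow,
      Polynomial.eval₂_C, Polynomial.eval₂_X, eq_ratCast, Rat.cast_intCast] at h₃
    rw [← h₃, ← Finset.sum_add_distrib]
    simp only [hu_def, Rat.cast_sum, Rat.cast_mul, Rat.cast_pow, Rat.cast_intCast]
    refine Finset.sum_congr rfl fun s _ => ?_
    simp only [hTz_def, hz_def, hw_def]
    ring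
  obtain ⟨C, hCpos, hC⟩ := huO.exists_pos
  set A : ℝ := ∑ s, |(a s : ℝ)|
  have hA : 0 ≤ A := Finset.sum_nonneg fun _ _ => abs_nonneg _
  have hsmall : ∀ᶠ n in atTop, A * C * ‖z n‖ < 1 := by
    have : Tendsto (fun n => A * C * ‖z n‖) atTop (nhds (A * C * 0)) := hxlim.const_mul _
    exact this.eventually_lt_const (by simp)
  have hvanish : ∀ᶠ n in atTop, u n = 0 := by
    filter_upwards [hsmall, hC.bound, hht, hxlim.eventually_lt_const one_pos]
      with n hn hun hhn hlt
    by_contra hne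
    have hlow := one_le_mul_norm_eval p K a (x n) (y n) hne
    have ht : 0 < ‖z n‖ := norm_pos_iff.mpr (hz0 n)
    have hlog : 0 < -Real.log ‖z n‖ := neg_pos.mpr (Real.log_neg ht hlt)
    set H := ratHeight (x n) + ratHeight (y n)
    have hHle : H ≤ K * -Real.log ‖z n‖ := by
      calc H ≤ 1 / ε * -Real.log ‖z n‖ := by
            rw [one_div, inv_mul_eq_div, le_div_iff₀ hε, mul_comm]
            exact hhn
        _ ≤ _ := by gcongr
    have hexp : Real.exp H * ‖z n‖ ^ K ≤ 1 := by
      rw [← Real.exp_log (pow_pos ht K), ← Real.exp_add, Real.exp_le_one_iff, Real.log_pow]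
      linarith
    have : (1 : ℝ) ≤ A * C * ‖z n‖ :=
      calc (1 : ℝ) ≤ A * Real.exp H ^ K * ‖((u n : ℚ) : ℚ_[p])‖ := hlow
        _ ≤ A * Real.exp H ^ K * (C * ‖z n ^ N‖) := by gcongr
        _ = A * C * ‖z n‖ * (Real.exp H * ‖z n‖ ^ K) ^ K := by
          rw [norm_pow]; simp only [N]; ring
        _ ≤ A * C * ‖z n‖ * 1 := by
          gcongr
          exact pow_le_one₀ (by positivity) hexp
        _ = _ := mul_one _
    linarith
  obtain ⟨m₀, hm₀⟩ := eventually_atTop.mp hvanish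
  let e : Fin (K + 1) × Fin (K + 1) → Fin 2 →₀ ℕ := fun s =>
    Finsupp.single 0 (s.1 : ℕ) + Finsupp.single 1 (s.2 : ℕ)
  have he : Function.Injective e := fun s t hst => by
    have h0 := DFunLike.congr_fun hst 0
    have h1 := DFunLike.congr_fun hst 1
    simp only [e, Finsupp.add_apply, Finsupp.single_apply] at h0 h1
    exact Prod.ext (Fin.ext (by simpa using h0)) (Fin.ext (by simpa using h1))
  refine ⟨∑ s, MvPolynomial.monomial (e s) (a s : ℚ), fun hP => ha0 (funext fun s => ?_), m₀,
    fun n hn => ?_⟩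
  · have h := congrArg (MvPolynomial.coeff (e s)) hP
    simpa [MvPolynomial.coeff_sum, MvPolynomial.coeff_monomial, he.eq_iff] using h
  · rw [← hm₀ n hn, map_sum]
    refine Finset.sum_congr rfl fun s _ => ?_
    rw [MvPolynomial.eval_monomial, Finsupp.prod_fintype _ _ (by simp)]
    simp [e, Fin.prod_univ_two, Finsupp.single_apply]
end
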